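/- Let q be an odd prime power with q ≡ 3 (mod 4), q > 3, and set d = (q-3)/2. Let λ = ∑_{x∈F_q} χ(x(x²+4x-1)) + ∑_{x∈F_q} χ(x(x²-2x+5)). If 5 is a nonsquare in F_q, then the number of quadruples (x₁,x₂,x₃,x₄) ∈ F_q⁴ with x₁ - x₂ + x₃ - x₄ = 0 and x₁^d - x₂^d + x₃^d - x₄^d = 0 equals (5q² + (λ-10)q - (λ-7))/2. -/

import Mathlib

open Finset

section CharacterSums

variable {F : Type*} [Field F] [Fintype F]

lemma ringChar_ne_two_of_card (hq3 : Fintype.card F % 4 = 3) : ringChar F ≠ 2 := by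
  intro h
  have := FiniteField.even_card_iff_char_two.mp h
  omega

lemma two_ne_zero_of_card (hq3 : Fintype.card F % 4 = 3) : (2 : F) ≠ 0 :=
  Ring.two_ne_zero (ringChar_ne_two_of_card hq3)

lemma sum_affine (g : F → ℤ) {a : F} (ha : a ≠ 0) (b : F) :
    ∑ x : F, g (a * x + b) = ∑ x : F, g x :=
  Equiv.sum_comp ((Equiv.mulLeft₀ a ha).trans (Equiv.addRight b)) g

variable [DecidableEq F]

lemma quadraticChar_neg (hq3 : Fintype.card F % 4 = 3) (a : F) :
    quadraticChar F (-a) = -quadraticChar F a := by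
  have h : quadraticChar F (-1) = -1 := by
    rw [quadraticChar_neg_one_iff_not_isSquare, FiniteField.isSquare_neg_one_iff]
    simpa using hq3
  rw [← neg_one_mul, map_mul, h, neg_one_mul]

lemma quadraticChar_inv (a : F) : quadraticChar F a⁻¹ = quadraticChar F a := by
  by_cases ha : a = 0
  · simp [ha]
  · have h : quadraticChar F a⁻¹ * quadraticChar F a = 1 := by
      rw [← map_mul, inv_mul_cancel₀ ha, map_one]
    rcases quadraticChar_dichotomy ha with h1 | h1 <;> rw [h1] at h ⊢ <;> linarith

lemma quadraticChar_four (hq3 : Fintype.card F % 4 = 3) : quadraticChar F 4 = 1 := by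
  have := quadraticChar_sq_one' (two_ne_zero_of_card hq3)
  norm_num at this
  exact this

lemma quadraticChar_mul_sq (a : F) {b : F} (hb : b ≠ 0) :
    quadraticChar F (a * b ^ 2) = quadraticChar F a := by
  rw [map_mul, quadraticChar_sq_one' hb, mul_one]

lemma ne_zero_of_quadraticChar_eq_one {a : F} (h : quadraticChar F a = 1) : a ≠ 0 := by
  rintro rfl
  simp at h

lemma ne_zero_of_quadraticChar_eq_neg_one {a : F} (h : quadraticChar F a = -1) : a ≠ 0 := by
  rintro rfl
  simp at h

lemma sq_add_four_ne_zero (hq3 : Fintype.card F % 4 = 3) (v : F) : v ^ 2 + 4 ≠ 0 := by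
  intro h
  have h1 : v ^ 2 = -4 := by linear_combination h
  have h2 : quadraticChar F (v ^ 2) = -1 := by
    rw [h1, quadraticChar_neg hq3, quadraticChar_four hq3]
  rw [map_pow] at h2
  nlinarith [sq_nonneg (quadraticChar F v)]

/-- The map `x ↦ x - x⁻¹` takes each value `w` exactly `1 + χ(w² + 4)` times. -/
lemma sum_sub_inv (hq3 : Fintype.card F % 4 = 3) (g : F → ℤ) :
    ∑ x : F with x ≠ 0, g (x - x⁻¹) = ∑ w : F, g w * (1 + quadraticChar F (w ^ 2 + 4)) := by
  have h2 := two_ne_zero_of_card hq3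
  rw [← Finset.sum_fiberwise (univ.filter fun x : F => x ≠ 0) (fun x => x - x⁻¹)]
  refine Finset.sum_congr rfl fun w _ => ?_
  have hcard : ((univ.filter fun x : F => x ≠ 0).filter fun x => x - x⁻¹ = w).card =
      {x : F | x ^ 2 = w ^ 2 + 4}.toFinset.card := by
    refine Finset.card_nbij' (fun x => 2 * x - w) (fun y => (y + w) / 2) ?_ ?_ ?_ ?_
    · intro x hx
      simp only [Finset.coe_filter, Finset.mem_filter, mem_univ, true_and, Set.mem_ofPred_eq] at hx
      obtain ⟨h0, rfl⟩ := hx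
      simp only [Set.coe_toFinset, Set.mem_ofPred_eq]
      field_simp
      ring
    · intro y hy
      simp only [Set.coe_toFinset, Set.mem_ofPred_eq] at hy
      have h0 : y + w ≠ 0 := by
        intro h
        have h4 : (2 : F) * 2 = 0 := by linear_combination (y - w) * h - hy
        simp [h2] at h4
      simp only [Finset.coe_filter, Finset.mem_filter, mem_univ, true_and, Set.mem_ofPred_eq]
      refine ⟨by positivity, ?_⟩
      field_simp
      linear_combination hy
    · intro x _
      field_simp
      ring
    · intro y _
      field_simp
      ring
  have hsum : ∑ x ∈ (univ.filter fun x : F => x ≠ 0).filter (fun x => x - x⁻¹ = w),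
      g (x - x⁻¹) = ∑ x ∈ (univ.filter fun x : F => x ≠ 0).filter (fun x => x - x⁻¹ = w), g w :=
    Finset.sum_congr rfl fun x hx => by rw [(Finset.mem_filter.mp hx).2]
  rw [hsum, Finset.sum_const, hcard, nsmul_eq_mul,
    quadraticChar_card_sqrts (ringChar_ne_two_of_card hq3)]
  ring

lemma sum_quadraticChar_sq_add_four (hq3 : Fintype.card F % 4 = 3) :
    ∑ v : F, quadraticChar F (v ^ 2 + 4) = -1 := by
  have h := sum_sub_inv hq3 (fun _ : F => (1 : ℤ))
  simp only [one_mul, Finset.sum_add_distrib, Finset.filter_ne' univ (0 : F),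
    Finset.sum_const, nsmul_eq_mul, mul_one, card_univ, Finset.card_erase_of_mem (mem_univ _)] at h
  have := Fintype.card_pos (α := F)
  push_cast [Nat.cast_sub this] at h
  linarith

lemma sum_ne_zero_inv (g : F → ℤ) :
    ∑ x : F with x ≠ 0, g x⁻¹ = ∑ x : F, g x - g 0 := by
  rw [Finset.filter_ne' univ (0 : F), ← Finset.add_sum_erase univ g (mem_univ 0),
    add_sub_cancel_left]
  exact Finset.sum_nbij' (fun x => x⁻¹) (fun x => x⁻¹) (by simp) (by simp) (by simp) (by simp)
    (by simp)

lemma sum_ne_zero_eq_sum (g : F → ℤ) (h0 : g 0 = 0) : ∑ x : F with x ≠ 0, g x = ∑ x : F, g x := by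
  rw [Finset.filter_ne' univ (0 : F), ← Finset.add_sum_erase univ g (mem_univ 0), h0, zero_add]

lemma sum_quadraticChar_add_four (hq3 : Fintype.card F % 4 = 3) :
    ∑ v : F, quadraticChar F (v + 4) = 0 := by
  have h := sum_affine (quadraticChar F) one_ne_zero (4 : F)
  simp only [one_mul] at h
  rw [h, quadraticChar_sum_zero (ringChar_ne_two_of_card hq3)]

lemma sum_quadraticChar_mul_add_four (hq3 : Fintype.card F % 4 = 3) :
    ∑ v : F, quadraticChar F (v * (v + 4)) = -1 := by
  have h4 : (4 : F) ≠ 0 := ne_zero_of_quadraticChar_eq_one (quadraticChar_four hq3)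
  rw [← sum_ne_zero_eq_sum _ (by simp)]
  have h : ∑ v : F with v ≠ 0, quadraticChar F (v * (v + 4)) =
      ∑ v : F with v ≠ 0, quadraticChar F (4 * v⁻¹ + 1) := by
    refine Finset.sum_congr rfl fun v hv => ?_
    have hv : v ≠ 0 := by simpa using hv
    rw [← quadraticChar_mul_sq (4 * v⁻¹ + 1) hv]
    congr 1
    field_simp
    ring
  rw [h, sum_ne_zero_inv fun v => quadraticChar F (4 * v + 1), sum_affine _ h4,
    quadraticChar_sum_zero (ringChar_ne_two_of_card hq3)]
  simp

lemma sum_quadraticChar_mul_sq_add_four (hq3 : Fintype.card F % 4 = 3) :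
    ∑ v : F, quadraticChar F (v * (v ^ 2 + 4)) = 0 := by
  have h : ∑ v : F, quadraticChar F (-v * ((-v) ^ 2 + 4)) =
      ∑ v : F, quadraticChar F (v * (v ^ 2 + 4)) :=
    Equiv.sum_comp (Equiv.neg F) fun v => quadraticChar F (v * (v ^ 2 + 4))
  simp only [neg_sq, neg_mul, quadraticChar_neg hq3, Finset.sum_neg_distrib] at h
  linarith

lemma sum_quadraticChar_add_four_mul (hq3 : Fintype.card F % 4 = 3) :
    ∑ v : F, quadraticChar F ((v + 4) * (v ^ 2 + 4)) =
      ∑ x : F, quadraticChar F (x * (x ^ 2 + 4 * x - 1)) := by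
  have h := sum_sub_inv hq3 (fun w : F => quadraticChar F (w + 4))
  simp only [mul_add, mul_one, Finset.sum_add_distrib, sum_quadraticChar_add_four hq3, zero_add,
    ← map_mul] at h
  rw [← sum_ne_zero_eq_sum (fun x => quadraticChar F (x * (x ^ 2 + 4 * x - 1))) (by simp)]
  simp only [mul_add] at h ⊢
  rw [← h]
  refine Finset.sum_congr rfl fun x hx => ?_
  have hx : x ≠ 0 := by simpa using hx
  rw [← quadraticChar_mul_sq (x - x⁻¹ + 4) hx]
  congr 1
  field_simp
  ring

lemma sum_quadraticChar_quartic (hq3 : Fintype.card F % 4 = 3) :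
    ∑ v : F, quadraticChar F (v * (v + 4) * (v ^ 2 + 4)) =
      ∑ x : F, quadraticChar F (x * (x ^ 2 - 2 * x + 5)) - 1 := by
  have h4 : (4 : F) ≠ 0 := ne_zero_of_quadraticChar_eq_one (quadraticChar_four hq3)
  rw [← sum_ne_zero_eq_sum _ (by simp), ← sum_affine _ h4 1]
  have h : ∑ v : F with v ≠ 0, quadraticChar F (v * (v + 4) * (v ^ 2 + 4)) =
      ∑ v : F with v ≠ 0,
        quadraticChar F ((4 * v⁻¹ + 1) * ((4 * v⁻¹ + 1) ^ 2 - 2 * (4 * v⁻¹ + 1) + 5)) := by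
    refine Finset.sum_congr rfl fun v hv => ?_
    have hv : v ≠ 0 := by simpa using hv
    have h2 := two_ne_zero_of_card hq3
    rw [← quadraticChar_mul_sq (v * (v + 4) * (v ^ 2 + 4)) h2,
      ← quadraticChar_mul_sq ((4 * v⁻¹ + 1) * _) (pow_ne_zero 2 hv)]
    congr 1
    field_simp
    ring
  rw [h, sum_ne_zero_inv fun v => quadraticChar F ((4 * v + 1) *
    ((4 * v + 1) ^ 2 - 2 * (4 * v + 1) + 5))]
  norm_num [quadraticChar_four hq3]

/-- Inclusion-exclusion count of the simultaneous square values of `v`, `v + 4`, `v² + 4`. -/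
lemma card_simultaneous_squares (hq3 : Fintype.card F % 4 = 3) :
    8 * ((univ.filter fun v : F => quadraticChar F v = 1 ∧ quadraticChar F (v + 4) = 1 ∧
      quadraticChar F (v ^ 2 + 4) = 1).card : ℤ) =
    Fintype.card F - 7 + (∑ x : F, quadraticChar F (x * (x ^ 2 + 4 * x - 1)) +
        ∑ x : F, quadraticChar F (x * (x ^ 2 - 2 * x + 5))) := by
  have hexp : ∑ v : F, (1 + quadraticChar F v) * (1 + quadraticChar F (v + 4)) *
      (1 + quadraticChar F (v ^ 2 + 4)) = Fintype.card F - 3 +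
        (∑ x : F, quadraticChar F (x * (x ^ 2 + 4 * x - 1)) +
        ∑ x : F, quadraticChar F (x * (x ^ 2 - 2 * x + 5))) := by
    calc _ = ∑ v : F, (1 + quadraticChar F v + quadraticChar F (v + 4) +
          quadraticChar F (v ^ 2 + 4) + quadraticChar F (v * (v + 4)) +
          quadraticChar F (v * (v ^ 2 + 4)) + quadraticChar F ((v + 4) * (v ^ 2 + 4)) +
          quadraticChar F (v * (v + 4) * (v ^ 2 + 4))) := by
            refine Finset.sum_congr rfl fun v _ => ?_
            simp only [map_mul]
            ring
      _ = _ := by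
        rw [Finset.sum_add_distrib, Finset.sum_add_distrib, Finset.sum_add_distrib,
          Finset.sum_add_distrib, Finset.sum_add_distrib, Finset.sum_add_distrib,
          Finset.sum_add_distrib, sum_quadraticChar_quartic hq3,
          sum_quadraticChar_add_four_mul hq3, sum_quadraticChar_mul_sq_add_four hq3,
          sum_quadraticChar_mul_add_four hq3, sum_quadraticChar_sq_add_four hq3,
          sum_quadraticChar_add_four hq3,
          quadraticChar_sum_zero (ringChar_ne_two_of_card hq3)]
        simp
        ring
  have hind : ∑ v : F, (1 + quadraticChar F v) * (1 + quadraticChar F (v + 4)) *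
      (1 + quadraticChar F (v ^ 2 + 4)) = ∑ v : F, (8 * (if quadraticChar F v = 1 ∧
        quadraticChar F (v + 4) = 1 ∧ quadraticChar F (v ^ 2 + 4) = 1 then 1 else 0) +
        if v = 0 then 4 else 0) := by
    refine Finset.sum_congr rfl fun v _ => ?_
    by_cases h0 : v = 0
    · subst h0
      simp [quadraticChar_four hq3]
    · by_cases h4 : v + 4 = 0
      · have : quadraticChar F v = -1 := by
          rw [eq_neg_of_add_eq_zero_left h4, quadraticChar_neg hq3, quadraticChar_four hq3]
        simp [this, h0]
      · rcases quadraticChar_dichotomy h0 with h1 | h1 <;>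
        rcases quadraticChar_dichotomy h4 with h2 | h2 <;>
        rcases quadraticChar_dichotomy (sq_add_four_ne_zero hq3 v) with h3 | h3 <;>
        simp [h0, h1, h2, h3]
  rw [hexp, Finset.sum_add_distrib, ← Finset.mul_sum, Finset.sum_boole] at hind
  simp only [Finset.sum_ite_eq', mem_univ, if_true] at hind
  linarith

end CharacterSums

section Slope

variable {F : Type*} [Field F]

/-- The ratio `(t ^ d - 1) / (t - 1) ^ d`, through which the power system separates. -/
def powSlope (d : ℕ) (t : F) : F := (t ^ d - 1) / (t - 1) ^ d

lemma powSlope_zero {d : ℕ} (hd0 : d ≠ 0) (heven : Even d) : powSlope d (0 : F) = -1 := by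
  simp [powSlope, hd0, heven.neg_pow]

lemma powSlope_div (d : ℕ) (x : F) {y : F} (hy : y ≠ 0) :
    powSlope d (x / y) = (x ^ d - y ^ d) / (x - y) ^ d := by
  have hyd := pow_ne_zero d hy
  rw [powSlope, div_sub_one hy, div_pow, div_pow, div_sub_one hyd, div_div_div_cancel_right₀ hyd]

variable [Fintype F] [DecidableEq F]

lemma pow_eq_quadraticChar_div (hq3 : Fintype.card F % 4 = 3) {d : ℕ}
    (hd : d = (Fintype.card F - 3) / 2) {a : F} (ha : a ≠ 0) :
    a ^ d = (quadraticChar F a : F) / a := by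
  rw [quadraticChar_eq_pow_of_char_ne_two' (ringChar_ne_two_of_card hq3), eq_div_iff ha, ← pow_succ]
  congr 1
  omega

/-- Since `5` is not a square, `x ↦ x ^ d` is additive only on trivial pairs. -/
lemma eq_zero_or_eq_zero_of_pow_add_pow (hq3 : Fintype.card F % 4 = 3) (hq : 3 < Fintype.card F)
    {d : ℕ} (hd : d = (Fintype.card F - 3) / 2) (h5 : ¬ IsSquare (5 : F)) {x y : F}
    (h : x ^ d + y ^ d = (x + y) ^ d) : x = 0 ∨ y = 0 := by
  have h2 := two_ne_zero_of_card hq3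
  have hd0 : d ≠ 0 := by omega
  have heven : Even d := by rw [Nat.even_iff]; omega
  by_contra! hxy
  obtain ⟨hx, hy⟩ := hxy
  by_cases hs : x + y = 0
  · rw [hs, zero_pow hd0, eq_neg_of_add_eq_zero_right hs, heven.neg_pow, ← two_mul] at h
    exact mul_ne_zero h2 (pow_ne_zero d hx) h
  have hfive : ∀ a b : F, a ≠ 0 → b ^ 2 = 5 * a ^ 2 → False := fun a b ha hab =>
    h5 ⟨b / a, by field_simp; exact hab.symm⟩
  rw [pow_eq_quadraticChar_div hq3 hd hx, pow_eq_quadraticChar_div hq3 hd hy,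
    pow_eq_quadraticChar_div hq3 hd hs] at h
  have hneg : quadraticChar F x = quadraticChar F y → (x + y) ^ 2 = -(x * y) → False := by
    intro hc he
    have := congrArg (quadraticChar F) he
    rw [quadraticChar_neg hq3, quadraticChar_sq_one' hs, map_mul, hc, ← sq,
      quadraticChar_sq_one hy] at this
    norm_num at this
  have hpos : quadraticChar F x = quadraticChar F (x + y) → (x + y) ^ 2 = x * y → False := by
    intro hc he
    have := congrArg (quadraticChar F) (show x * (x + y) = -y ^ 2 by linear_combination he)
    rw [quadraticChar_neg hq3, quadraticChar_sq_one' hy, map_mul, hc, ← sq,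
      quadraticChar_sq_one hs] at this
    norm_num at this
  rcases quadraticChar_dichotomy hx with h1 | h1 <;>
  rcases quadraticChar_dichotomy hy with h3 | h3 <;>
  rcases quadraticChar_dichotomy hs with h4 | h4 <;>
  rw [h1, h3, h4] at h <;> push_cast at h <;> field_simp at h
  · exact hpos (by rw [h1, h4]) (by linear_combination h)
  · exact hneg (by rw [h1, h3]) (by linear_combination h)
  · exact hfive x (2 * y - x) hx (by linear_combination 4 * h)
  · exact hfive x (2 * y + x) hx (by linear_combination 4 * h)
  · exact hfive x (2 * y + x) hx (by linear_combination -4 * h)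
  · exact hfive x (2 * y - x) hx (by linear_combination -4 * h)
  · exact hneg (by rw [h1, h3]) (by linear_combination -h)
  · exact hpos (by rw [h1, h4]) (by linear_combination -h)

lemma powSlope_eq (hq3 : Fintype.card F % 4 = 3) {d : ℕ}
    (hd : d = (Fintype.card F - 3) / 2) {t : F} (h0 : t ≠ 0) (h1 : t ≠ 1) :
    powSlope d t = (quadraticChar F (t - 1) : F) * (t - 1) * ((quadraticChar F t : F) / t - 1) := by
  have h1' : t - 1 ≠ 0 := sub_ne_zero.mpr h1
  rw [powSlope, pow_eq_quadraticChar_div hq3 hd h0, pow_eq_quadraticChar_div hq3 hd h1']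
  rcases quadraticChar_dichotomy h1' with h | h <;> rw [h] <;> push_cast <;> field_simp

lemma quadraticChar_inv_sub_one (hq3 : Fintype.card F % 4 = 3) {t : F} (h0 : t ≠ 0) :
    quadraticChar F (t⁻¹ - 1) = -(quadraticChar F (t - 1) * quadraticChar F t) := by
  rw [← quadraticChar_inv t, ← map_mul, ← quadraticChar_neg hq3]
  congr 1
  field_simp
  ring

lemma powSlope_inv (hq3 : Fintype.card F % 4 = 3) {d : ℕ}
    (hd : d = (Fintype.card F - 3) / 2) {t : F} (h0 : t ≠ 0) (h1 : t ≠ 1) :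
    powSlope d t⁻¹ = -powSlope d t := by
  rw [powSlope_eq hq3 hd (inv_ne_zero h0) (inv_eq_one.not.mpr h1), powSlope_eq hq3 hd h0 h1,
    quadraticChar_inv_sub_one hq3 h0, quadraticChar_inv]
  rcases quadraticChar_dichotomy h0 with h | h
  · rw [h]
    push_cast
    field_simp
  · rw [h]
    push_cast
    field_simp
    ring

lemma powSlope_injOn_squares (hq3 : Fintype.card F % 4 = 3) {d : ℕ}
    (hd : d = (Fintype.card F - 3) / 2) {t u : F} (ht : quadraticChar F t = 1) (ht1 : t ≠ 1)
    (hu : quadraticChar F u = 1) (hu1 : u ≠ 1) (h : powSlope d t = powSlope d u) : t = u := by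
  have ht0 := ne_zero_of_quadraticChar_eq_one ht
  have hu0 := ne_zero_of_quadraticChar_eq_one hu
  have ht' := sub_ne_zero.mpr ht1
  have hu' := sub_ne_zero.mpr hu1
  rw [powSlope_eq hq3 hd ht0 ht1, powSlope_eq hq3 hd hu0 hu1, ht, hu] at h
  have hsame : quadraticChar F (t - 1) = quadraticChar F (u - 1) →
      (t - 1) ^ 2 * u = (u - 1) ^ 2 * t → t = u := by
    intro hc he
    have : (t - u) * (t * u - 1) = 0 := by linear_combination he
    rcases mul_eq_zero.mp this with h | h
    · exact sub_eq_zero.mp h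
    · rw [← inv_eq_of_mul_eq_one_right (sub_eq_zero.mp h),
        quadraticChar_inv_sub_one hq3 ht0, ht] at hc
      rcases quadraticChar_dichotomy ht' with h | h <;> rw [h] at hc <;> norm_num at hc
  have hopp : (t - 1) ^ 2 * u = -((u - 1) ^ 2 * t) → t = u := by
    intro he
    have := congrArg (quadraticChar F) he
    rw [quadraticChar_neg hq3, map_mul, map_mul, quadraticChar_sq_one' ht',
      quadraticChar_sq_one' hu', ht, hu] at this
    norm_num at this
  rcases quadraticChar_dichotomy ht' with h3 | h3 <;>
  rcases quadraticChar_dichotomy hu' with h4 | h4 <;>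
  rw [h3, h4] at h <;> push_cast at h <;> field_simp at h
  · exact hsame (by rw [h3, h4]) (by linear_combination -h)
  · exact hopp (by linear_combination -h)
  · exact hopp (by linear_combination h)
  · exact hsame (by rw [h3, h4]) (by linear_combination h)

lemma powSlope_injOn_nonsquares (hq3 : Fintype.card F % 4 = 3) {d : ℕ}
    (hd : d = (Fintype.card F - 3) / 2) {t u : F} (ht : quadraticChar F t = -1)
    (hu : quadraticChar F u = -1) (h : powSlope d t = powSlope d u) : t = u := by
  have ht0 := ne_zero_of_quadraticChar_eq_neg_one ht
  have hu0 := ne_zero_of_quadraticChar_eq_neg_one hu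
  have ht1 : t ≠ 1 := by rintro rfl; simp at ht
  have hu1 : u ≠ 1 := by rintro rfl; simp at hu
  have ht' := sub_ne_zero.mpr ht1
  have hu' := sub_ne_zero.mpr hu1
  rw [powSlope_eq hq3 hd ht0 ht1, powSlope_eq hq3 hd hu0 hu1, ht, hu] at h
  have hsame : (t ^ 2 - 1) * u = (u ^ 2 - 1) * t → t = u := by
    intro he
    have : (t - u) * (t * u + 1) = 0 := by linear_combination he
    rcases mul_eq_zero.mp this with h | h
    · exact sub_eq_zero.mp h
    · have := congrArg (quadraticChar F) (eq_neg_of_add_eq_zero_left h)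
      rw [quadraticChar_neg hq3, map_mul, ht, hu] at this
      norm_num at this
  have hopp : quadraticChar F (t - 1) = -quadraticChar F (u - 1) →
      (t ^ 2 - 1) * u = -((u ^ 2 - 1) * t) → t = u := by
    intro hc he
    have : (t + u) * (t * u - 1) = 0 := by linear_combination he
    rcases mul_eq_zero.mp this with h | h
    · rw [eq_neg_of_add_eq_zero_left h, quadraticChar_neg hq3, hu] at ht
      norm_num at ht
    · rw [← inv_eq_of_mul_eq_one_right (sub_eq_zero.mp h),
        quadraticChar_inv_sub_one hq3 ht0, ht] at hc
      rcases quadraticChar_dichotomy ht' with h | h <;> rw [h] at hc <;> norm_num at hc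
  rcases quadraticChar_dichotomy ht' with h3 | h3 <;>
  rcases quadraticChar_dichotomy hu' with h4 | h4 <;>
  rw [h3, h4] at h <;> push_cast at h <;> field_simp at h
  · exact hsame (by linear_combination -h)
  · exact hopp (by rw [h3, h4]; norm_num) (by linear_combination -h)
  · exact hopp (by rw [h3, h4]) (by linear_combination h)
  · exact hsame (by linear_combination h)

lemma exists_square_powSlope_iff (hq3 : Fintype.card F % 4 = 3) {d : ℕ}
    (hd : d = (Fintype.card F - 3) / 2) (v : F) :
    (∃ t, quadraticChar F t = 1 ∧ t ≠ 1 ∧ powSlope d t = v) ↔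
      (quadraticChar F v = 1 ∧ quadraticChar F (v + 4) = 1) ∨
      (quadraticChar F (-v) = 1 ∧ quadraticChar F (-v + 4) = 1) := by
  have h2 := two_ne_zero_of_card hq3
  have hval : ∀ t : F, quadraticChar F t = 1 → t ≠ 1 →
      quadraticChar F ((t - 1) ^ 2 / t) = 1 ∧ quadraticChar F ((t - 1) ^ 2 / t + 4) = 1 := by
    intro t ht ht1
    have ht0 := ne_zero_of_quadraticChar_eq_one ht
    have hm : t + 1 ≠ 0 := by
      intro h
      rw [eq_neg_of_add_eq_zero_left h, quadraticChar_neg hq3, map_one] at ht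
      norm_num at ht
    have e : (t - 1) ^ 2 / t + 4 = (t + 1) ^ 2 / t := by field_simp; ring
    rw [e, div_eq_mul_inv, div_eq_mul_inv, map_mul, map_mul, quadraticChar_inv, ht,
      quadraticChar_sq_one' hm, quadraticChar_sq_one' (sub_ne_zero.mpr ht1)]
    simp
  have hex : ∀ w : F, quadraticChar F w = 1 → quadraticChar F (w + 4) = 1 →
      ∃ t, quadraticChar F t = 1 ∧ t ≠ 1 ∧ (powSlope d t = w) := by
    intro w hw hw4
    have hw0 := ne_zero_of_quadraticChar_eq_one hw
    have hp : w * (w + 4) ≠ 0 := mul_ne_zero hw0 (ne_zero_of_quadraticChar_eq_one hw4)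
    obtain ⟨y, hy⟩ := (quadraticChar_one_iff_isSquare hp).mp (by rw [map_mul, hw, hw4, mul_one])
    obtain ⟨t, rfl⟩ : ∃ t, y = 2 * t - (w + 2) := ⟨(y + (w + 2)) / 2, by field_simp; ring⟩
    have ht : (t - 1) ^ 2 = w * t := by
      apply mul_left_cancel₀ (pow_ne_zero 2 h2)
      linear_combination -hy
    have ht1 : t ≠ 1 := by
      rintro rfl
      exact hw0 (by linear_combination -ht)
    have ht' := sub_ne_zero.mpr ht1
    have htsq : quadraticChar F t = 1 := by
      have := congrArg (quadraticChar F) ht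
      rwa [quadraticChar_sq_one' ht', map_mul, hw, one_mul, eq_comm] at this
    have ht0 := ne_zero_of_quadraticChar_eq_one htsq
    rcases quadraticChar_dichotomy ht' with h | h
    · refine ⟨t⁻¹, by rwa [quadraticChar_inv], inv_eq_one.not.mpr ht1, ?_⟩
      rw [powSlope_inv hq3 hd ht0 ht1, powSlope_eq hq3 hd ht0 ht1, h, htsq]
      push_cast
      field_simp
      linear_combination ht
    · refine ⟨t, htsq, ht1, ?_⟩
      rw [powSlope_eq hq3 hd ht0 ht1, h, htsq]
      push_cast
      field_simp
      linear_combination ht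
  constructor
  · rintro ⟨t, ht, ht1, rfl⟩
    have ht0 := ne_zero_of_quadraticChar_eq_one ht
    rw [powSlope_eq hq3 hd ht0 ht1, ht]
    rcases quadraticChar_dichotomy (sub_ne_zero.mpr ht1) with h | h <;> rw [h]
    · right
      convert hval t ht ht1 using 3
      · push_cast; field_simp; ring
      · push_cast; field_simp; ring
    · left
      convert hval t ht ht1 using 3
      · push_cast; field_simp; ring
      · push_cast; field_simp; ring
  · rintro (⟨h, h'⟩ | ⟨h, h'⟩)
    · exact hex v h h'
    · obtain ⟨t, ht, ht1, hv⟩ := hex (-v) h h'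
      refine ⟨t⁻¹, by rwa [quadraticChar_inv], inv_eq_one.not.mpr ht1, ?_⟩
      rw [powSlope_inv hq3 hd (ne_zero_of_quadraticChar_eq_one ht) ht1, hv, neg_neg]

lemma exists_nonsquare_powSlope_iff (hq3 : Fintype.card F % 4 = 3) {d : ℕ}
    (hd : d = (Fintype.card F - 3) / 2) (v : F) :
    (∃ t, quadraticChar F t = -1 ∧ powSlope d t = v) ↔ quadraticChar F (v ^ 2 + 4) = 1 := by
  have h2 := two_ne_zero_of_card hq3
  constructor
  · rintro ⟨t, ht, rfl⟩
    have ht0 := ne_zero_of_quadraticChar_eq_neg_one ht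
    have ht1 : t ≠ 1 := by rintro rfl; simp at ht
    rw [quadraticChar_one_iff_isSquare (sq_add_four_ne_zero hq3 _), powSlope_eq hq3 hd ht0 ht1, ht]
    refine ⟨t + t⁻¹, ?_⟩
    rcases quadraticChar_dichotomy (sub_ne_zero.mpr ht1) with h | h <;> rw [h] <;>
      push_cast <;> field_simp <;> ring
  · intro h
    obtain ⟨y, hy⟩ := (quadraticChar_one_iff_isSquare (sq_add_four_ne_zero hq3 _)).mp h
    obtain ⟨s, rfl⟩ : ∃ s, y = 2 * s - v := ⟨(y + v) / 2, by field_simp; ring⟩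
    have hs : s ^ 2 - 1 = v * s := by
      apply mul_left_cancel₀ (pow_ne_zero 2 h2)
      linear_combination -hy
    have hs0 : s ≠ 0 := by
      rintro rfl
      norm_num at hs
    obtain ⟨t, ht, hvt⟩ : ∃ t, quadraticChar F t = -1 ∧ t ^ 2 - 1 = v * t := by
      rcases quadraticChar_dichotomy hs0 with h | h
      · refine ⟨-s⁻¹, by rw [quadraticChar_neg hq3, quadraticChar_inv, h], ?_⟩
        field_simp
        linear_combination -hs
      · exact ⟨s, h, hs⟩
    have ht0 := ne_zero_of_quadraticChar_eq_neg_one ht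
    have ht1 : t ≠ 1 := by rintro rfl; simp at ht
    rcases quadraticChar_dichotomy (sub_ne_zero.mpr ht1) with h | h
    · refine ⟨t⁻¹, by rwa [quadraticChar_inv], ?_⟩
      rw [powSlope_inv hq3 hd ht0 ht1, powSlope_eq hq3 hd ht0 ht1, h, ht]
      push_cast
      field_simp
      linear_combination hvt
    · refine ⟨t, ht, ?_⟩
      rw [powSlope_eq hq3 hd ht0 ht1, h, ht]
      push_cast
      field_simp
      linear_combination hvt

lemma eq_zero_of_powSlope_eq_neg_one (hq3 : Fintype.card F % 4 = 3) (hq : 3 < Fintype.card F)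
    {d : ℕ} (hd : d = (Fintype.card F - 3) / 2) (h5 : ¬ IsSquare (5 : F)) {t : F} (ht : t ≠ 1)
    (h : powSlope d t = -1) : t = 0 := by
  have ht' := sub_ne_zero.mpr ht
  have heven : Even d := by rw [Nat.even_iff]; omega
  rw [powSlope, div_eq_iff (pow_ne_zero d ht')] at h
  have h1 : t ^ d + (1 - t) ^ d = (t + (1 - t)) ^ d := by
    rw [← heven.neg_pow (1 - t), neg_sub, add_sub_cancel, one_pow]
    linear_combination h
  refine (eq_zero_or_eq_zero_of_pow_add_pow hq3 hq hd h5 h1).resolve_right ?_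
  rwa [sub_eq_zero, eq_comm]

/-- Pairs consisting of a square and a nonsquare with equal slope correspond to their common
slope. -/
lemma card_mixed_pairs (hq3 : Fintype.card F % 4 = 3) {d : ℕ}
    (hd : d = (Fintype.card F - 3) / 2) :
    (univ.filter fun p : F × F => (quadraticChar F p.1 = 1 ∧ p.1 ≠ 1 ∧ quadraticChar F p.2 = -1) ∧
      powSlope d p.1 = powSlope d p.2).card =
    2 * (univ.filter fun v : F => quadraticChar F v = 1 ∧ quadraticChar F (v + 4) = 1 ∧
      quadraticChar F (v ^ 2 + 4) = 1).card := by
  have himage : (univ.filter fun p : F × F =>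
      (quadraticChar F p.1 = 1 ∧ p.1 ≠ 1 ∧ quadraticChar F p.2 = -1) ∧
      powSlope d p.1 = powSlope d p.2).card =
      (univ.filter fun v : F => ((quadraticChar F v = 1 ∧ quadraticChar F (v + 4) = 1) ∨
      (quadraticChar F (-v) = 1 ∧ quadraticChar F (-v + 4) = 1)) ∧
      quadraticChar F (v ^ 2 + 4) = 1).card := by
    refine Finset.card_bij (fun p _ => powSlope d p.1) ?_ ?_ ?_
    · rintro ⟨t, u⟩ hp
      simp only [mem_filter, mem_univ, true_and] at hp ⊢
      obtain ⟨⟨ht, ht1, hu⟩, h⟩ := hp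
      exact ⟨(exists_square_powSlope_iff hq3 hd _).mp ⟨t, ht, ht1, rfl⟩,
        (exists_nonsquare_powSlope_iff hq3 hd _).mp ⟨u, hu, h.symm⟩⟩
    · rintro ⟨t, u⟩ hp ⟨t', u'⟩ hp' h
      simp only [mem_filter, mem_univ, true_and] at hp hp' h
      obtain ⟨⟨ht, ht1, hu⟩, e⟩ := hp
      obtain ⟨⟨ht', ht1', hu'⟩, e'⟩ := hp'
      rw [Prod.mk.injEq]
      exact ⟨powSlope_injOn_squares hq3 hd ht ht1 ht' ht1' h,
        powSlope_injOn_nonsquares hq3 hd hu hu' (by rw [← e, h, e'])⟩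
    · intro v hv
      simp only [mem_filter, mem_univ, true_and] at hv
      obtain ⟨t, ht, ht1, e⟩ := (exists_square_powSlope_iff hq3 hd _).mpr hv.1
      obtain ⟨u, hu, e'⟩ := (exists_nonsquare_powSlope_iff hq3 hd _).mpr hv.2
      exact ⟨(t, u), mem_filter.mpr ⟨mem_univ _, ⟨ht, ht1, hu⟩, e.trans e'.symm⟩, e⟩
  have hneg : (univ.filter fun v : F => quadraticChar F (-v) = 1 ∧ quadraticChar F (-v + 4) = 1 ∧
      quadraticChar F (v ^ 2 + 4) = 1).card = (univ.filter fun v : F => quadraticChar F v = 1 ∧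
      quadraticChar F (v + 4) = 1 ∧ quadraticChar F (v ^ 2 + 4) = 1).card :=
    Finset.card_nbij' (fun v => -v) (fun v => -v) (by intro v; simp) (by intro v; simp)
      (by intro v; simp) (by intro v; simp)
  rw [himage, two_mul]
  nth_rw 2 [← hneg]
  rw [← Finset.card_union_of_disjoint]
  · congr 1
    ext v
    simp only [mem_filter, mem_union, mem_univ, true_and]
    tauto
  · rw [Finset.disjoint_filter]
    rintro v _ ⟨h, -⟩ ⟨h', -⟩
    rw [quadraticChar_neg hq3] at h'
    omega

lemma card_equal_slope_pairs (hq3 : Fintype.card F % 4 = 3) (hq : 3 < Fintype.card F)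
    {d : ℕ} (hd : d = (Fintype.card F - 3) / 2) (h5 : ¬ IsSquare (5 : F)) :
    (univ.filter fun p : F × F => p.1 ≠ 1 ∧ p.2 ≠ 1 ∧ powSlope d p.1 = powSlope d p.2).card =
    (Fintype.card F - 1) + 4 * (univ.filter fun v : F => quadraticChar F v = 1 ∧
      quadraticChar F (v + 4) = 1 ∧ quadraticChar F (v ^ 2 + 4) = 1).card := by
  have hd0 : d ≠ 0 := by omega
  have heven : Even d := by rw [Nat.even_iff]; omega
  have hdiag : (univ.filter fun p : F × F => p.1 = p.2 ∧ p.1 ≠ 1).card = Fintype.card F - 1 := by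
    rw [← Finset.card_univ, ← Finset.card_erase_of_mem (mem_univ (1 : F))]
    refine Finset.card_nbij' (fun p => p.1) (fun t => (t, t)) ?_ ?_ ?_ ?_
    · rintro ⟨t, u⟩; simp
    · intro t; simp
    · rintro ⟨t, u⟩; simp +contextual
    · intro t; simp
  have hswap : (univ.filter fun p : F × F =>
      (quadraticChar F p.2 = 1 ∧ p.2 ≠ 1 ∧ quadraticChar F p.1 = -1) ∧
      powSlope d p.2 = powSlope d p.1).card = (univ.filter fun p : F × F =>
      (quadraticChar F p.1 = 1 ∧ p.1 ≠ 1 ∧ quadraticChar F p.2 = -1) ∧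
      powSlope d p.1 = powSlope d p.2).card :=
    Finset.card_nbij' Prod.swap Prod.swap (by intro v; simp) (by intro v; simp)
      (by intro v; simp) (by intro v; simp)
  have hsplit : (univ.filter fun p : F × F => p.1 ≠ 1 ∧ p.2 ≠ 1 ∧ powSlope d p.1 = powSlope d p.2) =
      (univ.filter fun p : F × F => p.1 = p.2 ∧ p.1 ≠ 1) ∪
      ((univ.filter fun p : F × F =>
        (quadraticChar F p.1 = 1 ∧ p.1 ≠ 1 ∧ quadraticChar F p.2 = -1) ∧
        powSlope d p.1 = powSlope d p.2) ∪
      (univ.filter fun p : F × F =>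
        (quadraticChar F p.2 = 1 ∧ p.2 ≠ 1 ∧ quadraticChar F p.1 = -1) ∧
        powSlope d p.2 = powSlope d p.1)) := by
    ext ⟨t, u⟩
    simp only [mem_filter, mem_union, mem_univ, true_and]
    constructor
    · rintro ⟨ht, hu, h⟩
      by_cases ht0 : t = 0
      · subst ht0
        rw [powSlope_zero hd0 heven] at h
        exact Or.inl ⟨(eq_zero_of_powSlope_eq_neg_one hq3 hq hd h5 hu h.symm).symm, ht⟩
      by_cases hu0 : u = 0
      · subst hu0
        rw [powSlope_zero hd0 heven] at h
        exact absurd (eq_zero_of_powSlope_eq_neg_one hq3 hq hd h5 ht h) ht0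
      rcases quadraticChar_dichotomy ht0 with h1 | h1 <;>
      rcases quadraticChar_dichotomy hu0 with h2 | h2
      · exact Or.inl ⟨powSlope_injOn_squares hq3 hd h1 ht h2 hu h, ht⟩
      · exact Or.inr (Or.inl ⟨⟨h1, ht, h2⟩, h⟩)
      · exact Or.inr (Or.inr ⟨⟨h2, hu, h1⟩, h.symm⟩)
      · exact Or.inl ⟨powSlope_injOn_nonsquares hq3 hd h1 h2 h, ht⟩
    · have hne : ∀ x : F, quadraticChar F x = -1 → x ≠ 1 := by rintro x hx rfl; simp at hx
      rintro (⟨rfl, h⟩ | ⟨⟨h1, h2, h3⟩, h⟩ | ⟨⟨h1, h2, h3⟩, h⟩)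
      · exact ⟨h, h, rfl⟩
      · exact ⟨h2, hne u h3, h⟩
      · exact ⟨hne t h3, h2, h.symm⟩
  rw [hsplit, Finset.card_union_of_disjoint, Finset.card_union_of_disjoint, hdiag, hswap,
    card_mixed_pairs hq3 hd]
  · ring
  · rw [Finset.disjoint_filter]
    rintro p _ ⟨⟨h, -, -⟩, -⟩ ⟨⟨-, -, h'⟩, -⟩
    omega
  · rw [Finset.disjoint_union_right, Finset.disjoint_filter, Finset.disjoint_filter]
    constructor
    · rintro p _ ⟨e, -⟩ ⟨⟨h, -, h'⟩, -⟩
      rw [e] at h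
      omega
    · rintro p _ ⟨e, -⟩ ⟨⟨h, -, h'⟩, -⟩
      rw [e] at h'
      omega

/-- The solutions split into those with `x₁ = x₂`, those with `x₂ = 0 ≠ x₁`, and those
parametrised by `x₃` and the two ratios `x₁ / x₂`, `x₄ / x₃`. -/
lemma card_solutions (hq3 : Fintype.card F % 4 = 3) (hq : 3 < Fintype.card F)
    {d : ℕ} (hd : d = (Fintype.card F - 3) / 2) (h5 : ¬ IsSquare (5 : F)) :
    (univ.filter fun x : F × F × F × F => x.1 - x.2.1 + x.2.2.1 - x.2.2.2 = 0 ∧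
        x.1 ^ d - x.2.1 ^ d + x.2.2.1 ^ d - x.2.2.2 ^ d = 0).card =
    Fintype.card F ^ 2 + (Fintype.card F - 1) + (Fintype.card F - 1) *
      (univ.filter fun p : F × F =>
        p.1 ≠ 1 ∧ p.2 ≠ 1 ∧ powSlope d p.1 = powSlope d p.2).card := by
  have hd0 : d ≠ 0 := by omega
  have hadd := @eq_zero_or_eq_zero_of_pow_add_pow F _ _ _ hq3 hq d hd h5
  set S := univ.filter fun x : F × F × F × F => x.1 - x.2.1 + x.2.2.1 - x.2.2.2 = 0 ∧
        x.1 ^ d - x.2.1 ^ d + x.2.2.1 ^ d - x.2.2.2 ^ d = 0 with hS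
  have hunits : (univ.filter fun y : F => y ≠ 0).card = Fintype.card F - 1 := by
    rw [Finset.filter_ne' univ (0 : F), Finset.card_erase_of_mem (mem_univ _), card_univ]
  have hfst : (S.filter fun x => x.1 = x.2.1).card = Fintype.card F ^ 2 := by
    rw [sq, ← Fintype.card_prod, ← Finset.card_univ]
    refine Finset.card_nbij' (fun x => (x.1, x.2.2.1)) (fun p => (p.1, p.1, p.2, p.2)) ?_ ?_ ?_ ?_
    · intro x; simp
    · intro p; simp [hS]
    · rintro ⟨a, b, c, e⟩ hx
      simp only [hS, coe_filter, mem_filter, mem_univ, true_and, Set.mem_ofPred_eq] at hx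
      obtain ⟨⟨h, -⟩, rfl⟩ := hx
      have : c = e := by linear_combination h
      simp [this]
    · intro p; simp
  have hsnd : ((S.filter fun x => ¬ x.1 = x.2.1).filter fun x => x.2.1 = 0).card =
      Fintype.card F - 1 := by
    rw [← hunits]
    refine Finset.card_nbij' (fun x => x.1) (fun y => (y, 0, 0, y)) ?_ ?_ ?_ ?_
    · rintro ⟨a, b, c, e⟩ hx
      simp only [hS, coe_filter, mem_filter, mem_univ, true_and, Set.mem_ofPred_eq] at hx ⊢
      obtain ⟨⟨-, h⟩, rfl⟩ := hx
      exact h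
    · intro y; simp [hS, hd0]
    · rintro ⟨a, b, c, e⟩ hx
      simp only [hS, coe_filter, mem_filter, mem_univ, true_and, Set.mem_ofPred_eq] at hx
      obtain ⟨⟨⟨h1, h2⟩, ha⟩, rfl⟩ := hx
      obtain rfl : e = a + c := by linear_combination -h1
      rw [zero_pow hd0] at h2
      have := (hadd (x := a) (y := c) (by linear_combination h2)).resolve_left ha
      simp [this]
    · intro y; simp
  have hthd : ((S.filter fun x => ¬ x.1 = x.2.1).filter fun x => ¬ x.2.1 = 0).card =
      (Fintype.card F - 1) * (univ.filter fun p : F × F =>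
        p.1 ≠ 1 ∧ p.2 ≠ 1 ∧ powSlope d p.1 = powSlope d p.2).card := by
    have hthree : ∀ a b c e : F, a - b + c - e = 0 → a ^ d - b ^ d + c ^ d - e ^ d = 0 → a ≠ b →
        b ≠ 0 → c ≠ 0 := by
      rintro a b c e h1 h2 hab hb rfl
      obtain rfl : a = b + e := by linear_combination h1
      rw [zero_pow hd0] at h2
      have := (hadd (x := b) (y := e) (by linear_combination -h2)).resolve_left hb
      exact hab (by rw [this, add_zero])
    rw [← hunits, ← Finset.card_product]
    refine Finset.card_nbij' (fun x => (x.2.2.1, x.1 / x.2.1, x.2.2.2 / x.2.2.1))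
      (fun p => (p.2.1 * (p.1 * (p.2.2 - 1) / (p.2.1 - 1)), p.1 * (p.2.2 - 1) / (p.2.1 - 1),
        p.1, p.2.2 * p.1)) ?_ ?_ ?_ ?_
    · rintro ⟨a, b, c, e⟩ hx
      simp only [hS, coe_filter, mem_filter, mem_univ, true_and, Set.mem_ofPred_eq] at hx
      obtain ⟨⟨⟨h1, h2⟩, hab⟩, hb⟩ := hx
      have hc := hthree a b c e h1 h2 hab hb
      simp only [coe_product, coe_filter, mem_univ, true_and, Set.mem_prod, Set.mem_ofPred_eq]
      refine ⟨hc, ?_, ?_, ?_⟩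
      · rwa [ne_eq, div_eq_one_iff_eq hb]
      · rw [ne_eq, div_eq_one_iff_eq hc]
        rintro rfl
        exact hab (by linear_combination h1)
      · rw [powSlope_div d a hb, powSlope_div d e hc,
          show a - b = e - c by linear_combination h1,
          show a ^ d - b ^ d = e ^ d - c ^ d by linear_combination h2]
    · rintro ⟨c, t, u⟩ hp
      simp only [coe_product, coe_filter, mem_univ, true_and, Set.mem_prod,
        Set.mem_ofPred_eq] at hp
      obtain ⟨hc, ht, hu, h⟩ := hp
      have ht' := sub_ne_zero.mpr ht
      have hu' := sub_ne_zero.mpr hu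
      simp only [hS, coe_filter, mem_filter, mem_univ, true_and, Set.mem_ofPred_eq]
      have hb : c * (u - 1) / (t - 1) ≠ 0 := div_ne_zero (mul_ne_zero hc hu') ht'
      set b := c * (u - 1) / (t - 1) with hbdef
      have hdiff : t * b - b = u * c - c := by
        rw [hbdef]; field_simp
      have hdiff0 : u * c - c ≠ 0 := by
        rw [← sub_one_mul]; exact mul_ne_zero hu' hc
      rw [← mul_div_cancel_right₀ t hb, ← mul_div_cancel_right₀ u hc, powSlope_div d _ hb,
        powSlope_div d _ hc, hdiff, div_left_inj' (pow_ne_zero d hdiff0)] at h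
      refine ⟨⟨⟨by linear_combination hdiff, by linear_combination h⟩, ?_⟩, hb⟩
      intro hab
      exact hdiff0 (by rw [← hdiff, hab, sub_self])
    · rintro ⟨a, b, c, e⟩ hx
      simp only [hS, coe_filter, mem_filter, mem_univ, true_and, Set.mem_ofPred_eq] at hx
      obtain ⟨⟨⟨h1, h2⟩, hab⟩, hb⟩ := hx
      have hc := hthree a b c e h1 h2 hab hb
      have hab' := sub_ne_zero.mpr hab
      have hb' : c * (e / c - 1) / (a / b - 1) = b := by
        have : a / b - 1 ≠ 0 := by
          rwa [div_sub_one hb, ne_eq, div_eq_zero_iff, not_or, and_iff_left hb]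
        rw [div_eq_iff this]
        field_simp
        linear_combination -h1
      simp only [hb', div_mul_cancel₀ a hb, div_mul_cancel₀ e hc]
    · rintro ⟨c, t, u⟩ hp
      simp only [coe_product, coe_filter, mem_univ, true_and, Set.mem_prod,
        Set.mem_ofPred_eq] at hp
      obtain ⟨hc, ht, hu, h⟩ := hp
      have hb : c * (u - 1) / (t - 1) ≠ 0 :=
        div_ne_zero (mul_ne_zero hc (sub_ne_zero.mpr hu)) (sub_ne_zero.mpr ht)
      simp only [mul_div_cancel_right₀ t hb, mul_div_cancel_right₀ u hc]
  rw [← Finset.card_filter_add_card_filter_not (s := S) (fun x => x.1 = x.2.1),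
    ← Finset.card_filter_add_card_filter_not (s := S.filter fun x => ¬ x.1 = x.2.1)
      (fun x => x.2.1 = 0), hfst, hsnd, hthd, add_assoc]

end Slope

theorem stmt_13 (F : Type*) [Field F] [Fintype F] [DecidableEq F]
    (hq3 : Fintype.card F % 4 = 3) (hq : 3 < Fintype.card F)
    (d : ℕ) (hd : d = (Fintype.card F - 3) / 2)
    (lam : ℤ)
    (hlam : lam = (∑ x : F, quadraticChar F (x * (x ^ 2 + 4 * x - 1))) +
        ∑ x : F, quadraticChar F (x * (x ^ 2 - 2 * x + 5)))
    (h5 : ¬ IsSquare (5 : F)) :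
    2 * ({x : F × F × F × F |
        x.1 - x.2.1 + x.2.2.1 - x.2.2.2 = 0 ∧
        x.1 ^ d - x.2.1 ^ d + x.2.2.1 ^ d - x.2.2.2 ^ d = 0}.ncard : ℤ) =
      5 * (Fintype.card F : ℤ) ^ 2 + (lam - 10) * (Fintype.card F : ℤ) - (lam - 7) := by 
  have hset : {x : F × F × F × F | x.1 - x.2.1 + x.2.2.1 - x.2.2.2 = 0 ∧
      x.1 ^ d - x.2.1 ^ d + x.2.2.1 ^ d - x.2.2.2 ^ d = 0}.ncard =
      (univ.filter fun x : F × F × F × F => x.1 - x.2.1 + x.2.2.1 - x.2.2.2 = 0 ∧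
        x.1 ^ d - x.2.1 ^ d + x.2.2.1 ^ d - x.2.2.2 ^ d = 0).card := by
    rw [← Set.ncard_coe_finset, Finset.coe_filter]
    simp
  have hK := card_simultaneous_squares hq3
  rw [← hlam] at hK
  rw [hset, card_solutions hq3 hq hd h5, card_equal_slope_pairs hq3 hq hd h5]
  push_cast [Nat.cast_sub (show 1 ≤ Fintype.card F by omega)]
  linear_combination ((Fintype.card F : ℤ) - 1) * hK
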